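/- Let N ≥ 0 be an integer, C > 0 and R > 0 real numbers, and let f(z) = ∑_{k=0}^∞ a_k z^k be an analytic function on the disk D_R = {z : |z| < R}, not identically zero, satisfying the (N,R,C)-Taylor domination property: |a_k|·R^k ≤ C·max_{0≤i≤N} |a_i|·R^i for all k ≥ N+1. Then for any R' with 0 < R' < R/4, the set of zeros of f in the disk D_{R'} = {z : |z| < R'} is finite and has at most 5N + 5·log(C+2) elements (log denoting natural logarithm). -/

import Mathlib

/-- A function given by a convergent power series on a disk has that series as its
formal power series there. -/
lemma hasFPowerSeriesOnBall_ofScalars_of_hasSum {R : ℝ} (hR : 0 < R) {a : ℕ → ℂ} {f : ℂ → ℂ}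
    (hf : ∀ z ∈ Metric.ball (0 : ℂ) R, HasSum (fun k : ℕ => a k * z ^ k) (f z)) :
    HasFPowerSeriesOnBall f (FormalMultilinearSeries.ofScalars ℂ a) 0 (ENNReal.ofReal R) where
  r_le := by
    refine ENNReal.le_of_forall_nnreal_lt fun r hr => ?_
    have hrR : (r : ℝ) < R := by
      rwa [← ENNReal.ofReal_coe_nnreal, ENNReal.ofReal_lt_ofReal_iff hR] at hr
    refine FormalMultilinearSeries.le_radius_of_tendsto _ (l := 0) ?_
    have h := (hf (r : ℝ) (by simpa using hrR)).summable.tendsto_atTop_zero.norm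
    simpa [FormalMultilinearSeries.ofScalars_norm] using h
  r_pos := by simpa using hR
  hasSum := by
    intro y hy
    have hy' : y ∈ Metric.ball (0 : ℂ) R := by
      rwa [Metric.eball_ofReal] at hy
    simpa [mul_comm] using hf y hy'

/-- Cauchy's estimate for the coefficients of a power series. -/
lemma norm_coeff_mul_pow_le_of_forall_mem_sphere_norm_le {R r B : ℝ} (hr : 0 < r) (hrR : r < R)
    {a : ℕ → ℂ} {f : ℂ → ℂ}
    (hf : ∀ z ∈ Metric.ball (0 : ℂ) R, HasSum (fun k : ℕ => a k * z ^ k) (f z))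
    (hB : ∀ z ∈ Metric.sphere (0 : ℂ) r, ‖f z‖ ≤ B) (m : ℕ) : ‖a m‖ * r ^ m ≤ B := by
  have hps := hasFPowerSeriesOnBall_ofScalars_of_hasSum (hr.trans hrR) hf
  have hd : DifferentiableOn ℂ f (Metric.ball 0 R) := by
    simpa [Metric.eball_ofReal] using hps.differentiableOn
  have hcauchy := Complex.norm_iteratedDeriv_le_of_forall_mem_sphere_norm_le m hr
    (hd.diffContOnCl_ball (Metric.closedBall_subset_ball hrR)) hB
  have hcoeff : iteratedDeriv m f 0 = m.factorial * a m := by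
    rw [iteratedDeriv_eq_iteratedFDeriv, ← hps.factorial_smul 1 m]
    simp
  have hfac : (0 : ℝ) < m.factorial := by positivity
  rw [hcoeff, norm_mul, Complex.norm_natCast, mul_div_assoc] at hcauchy
  exact (le_div_iff₀ (pow_pos hr m)).1 (le_of_mul_le_mul_left hcauchy hfac)

/-- Finitely many zeros of a holomorphic function can be divided out. -/
lemma exists_differentiableOn_eq_prod_sub_mul {U : Set ℂ} (hU : IsOpen U) {f : ℂ → ℂ}
    (hf : DifferentiableOn ℂ f U) (T : Finset ℂ) (hTU : ∀ w ∈ T, w ∈ U) (hT : ∀ w ∈ T, f w = 0) :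
    ∃ g : ℂ → ℂ, DifferentiableOn ℂ g U ∧ ∀ z, f z = (∏ w ∈ T, (z - w)) * g z := by
  classical
  induction T using Finset.induction_on with
  | empty => exact ⟨f, hf, by simp⟩
  | insert c T hc ih =>
    obtain ⟨g, hg, hfg⟩ := ih (fun w hw => hTU w (Finset.mem_insert_of_mem hw))
      (fun w hw => hT w (Finset.mem_insert_of_mem hw))
    have hgc : g c = 0 := by
      have h := hT c (Finset.mem_insert_self c T)
      rw [hfg c] at h
      refine (mul_eq_zero.1 h).resolve_left (Finset.prod_ne_zero_iff.2 fun w hw => ?_)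
      exact sub_ne_zero.2 fun hcw => hc (hcw ▸ hw)
    refine ⟨dslope g c, (Complex.differentiableOn_dslope
      (hU.mem_nhds (hTU c (Finset.mem_insert_self c T)))).2 hg, fun z => ?_⟩
    have h := sub_smul_dslope g c z
    rw [hgc, sub_zero, smul_eq_mul] at h
    rw [Finset.prod_insert hc, hfg z, ← h]
    ring

/-- A holomorphic function with many zeros close to the origin is small near the origin. -/
lemma norm_mul_pow_card_le_of_zeros {R r s t S : ℝ} (hr : 0 ≤ r) (hrs : r < s) (hts : t < s)
    (hsR : s < R) {f : ℂ → ℂ} (hf : DifferentiableOn ℂ f (Metric.ball 0 R))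
    (hS : ∀ z ∈ Metric.sphere (0 : ℂ) s, ‖f z‖ ≤ S) (T : Finset ℂ)
    (hTt : ∀ w ∈ T, ‖w‖ ≤ t) (hT : ∀ w ∈ T, f w = 0) {z : ℂ} (hz : ‖z‖ = r) :
    ‖f z‖ * (s - t) ^ T.card ≤ (r + t) ^ T.card * S := by
  have hs : 0 < s := hr.trans_lt hrs
  have hst : 0 < (s - t) ^ T.card := pow_pos (sub_pos.2 hts) _
  obtain ⟨g, hg, hfg⟩ := exists_differentiableOn_eq_prod_sub_mul Metric.isOpen_ball hf T
    (fun w hw => by simpa using (hTt w hw).trans_lt (hts.trans hsR)) hT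
  have hgs : ∀ y ∈ Metric.sphere (0 : ℂ) s, ‖g y‖ ≤ S / (s - t) ^ T.card := by
    intro y hy
    have hprod : (s - t) ^ T.card ≤ ∏ w ∈ T, ‖y - w‖ := by
      rw [← Finset.prod_const]
      refine Finset.prod_le_prod (fun _ _ => (sub_pos.2 hts).le) fun w hw => ?_
      have hys : ‖y‖ = s := by simpa using hy
      linarith [norm_sub_norm_le y w, hTt w hw]
    rw [le_div_iff₀ hst]
    have h := hS y hy
    rw [hfg y, norm_mul, norm_prod] at h
    calc ‖g y‖ * (s - t) ^ T.card ≤ ‖g y‖ * ∏ w ∈ T, ‖y - w‖ := by gcongr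
      _ ≤ S := by rwa [mul_comm]
  have hgz : ‖g z‖ ≤ S / (s - t) ^ T.card := by
    refine Complex.norm_le_of_forall_mem_frontier_norm_le (U := Metric.ball 0 s)
      Metric.isBounded_ball (hg.diffContOnCl_ball (Metric.closedBall_subset_ball hsR)) ?_ ?_
    · rwa [frontier_ball _ hs.ne']
    · exact subset_closure (by simpa [hz] using hrs)
  have hprod : ∏ w ∈ T, ‖z - w‖ ≤ (r + t) ^ T.card := by
    rw [← Finset.prod_const]
    refine Finset.prod_le_prod (fun _ _ => norm_nonneg _) fun w hw => ?_
    linarith [norm_sub_le z w, hTt w hw]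
  rw [hfg z, norm_mul, norm_prod, mul_assoc]
  rw [le_div_iff₀ hst] at hgz
  gcongr
  exact (Finset.prod_nonneg fun _ _ => norm_nonneg _).trans hprod

/-- A power series with bounded normalized coefficients is bounded on smaller circles. -/
lemma norm_le_of_hasSum_of_norm_coeff_mul_pow_le {R q B : ℝ} (hq : 0 ≤ q) (hq1 : q < 1)
    {a : ℕ → ℂ} {z c : ℂ} (hz : ‖z‖ = q * R) (ha : ∀ k, ‖a k‖ * R ^ k ≤ B)
    (hc : HasSum (fun k : ℕ => a k * z ^ k) c) : ‖c‖ ≤ B / (1 - q) := by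
  rw [← hc.tsum_eq]
  refine tsum_of_norm_bounded ((hasSum_geometric_of_lt_one hq hq1).mul_left B) fun k => ?_
  rw [norm_mul, norm_pow, hz, mul_pow]
  calc ‖a k‖ * (q ^ k * R ^ k) = ‖a k‖ * R ^ k * q ^ k := by ring
    _ ≤ B * q ^ k := by gcongr; exact ha k

/-- If all normalized coefficients are at most `K` times the `m`-th one, which does not vanish,
then a finite set `T` of zeros in `D_{R/4}` satisfies `2 ^ |T| ≤ 16 ^ m * (8 * K)`. -/
lemma two_pow_card_zeros_le {R K : ℝ} (hR : 0 < R) {a : ℕ → ℂ} {f : ℂ → ℂ}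
    (hf : ∀ z ∈ Metric.ball (0 : ℂ) R, HasSum (fun k : ℕ => a k * z ^ k) (f z)) {m : ℕ}
    (hm : a m ≠ 0) (ha : ∀ k, ‖a k‖ * R ^ k ≤ K * (‖a m‖ * R ^ m)) (T : Finset ℂ)
    (hTR : ∀ w ∈ T, ‖w‖ ≤ R / 4) (hT : ∀ w ∈ T, f w = 0) :
    (2 : ℝ) ^ T.card ≤ 16 ^ m * (8 * K) := by
  have hd : DifferentiableOn ℂ f (Metric.ball 0 R) := by
    simpa [Metric.eball_ofReal] using
      (hasFPowerSeriesOnBall_ofScalars_of_hasSum hR hf).differentiableOn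
  have hS : ∀ z ∈ Metric.sphere (0 : ℂ) (7 / 8 * R), ‖f z‖ ≤ 8 * K * (‖a m‖ * R ^ m) := by
    intro z hz
    have hz' : ‖z‖ = 7 / 8 * R := by simpa using hz
    have h := norm_le_of_hasSum_of_norm_coeff_mul_pow_le (by norm_num) (by norm_num) hz' ha
      (hf z (by rw [mem_ball_zero_iff]; linarith))
    refine h.trans_eq ?_
    ring
  have hsmall : ∀ z ∈ Metric.sphere (0 : ℂ) (R / 16),
      ‖f z‖ ≤ 8 * K * (‖a m‖ * R ^ m) / 2 ^ T.card := by
    intro z hz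
    have h := norm_mul_pow_card_le_of_zeros (r := R / 16) (by positivity) (by linarith)
      (by linarith) (by linarith) hd hS T hTR hT (by simpa using hz)
    rw [show 7 / 8 * R - R / 4 = (R / 16 + R / 4) * 2 by ring, mul_pow, mul_left_comm] at h
    rw [le_div_iff₀ (by positivity)]
    exact le_of_mul_le_mul_left h (by positivity)
  have h := norm_coeff_mul_pow_le_of_forall_mem_sphere_norm_le (by positivity) (by linarith)
    hf hsmall m
  have hpos : 0 < ‖a m‖ * R ^ m := by positivity
  rw [le_div_iff₀ (by positivity), div_pow] at h
  refine le_of_mul_le_mul_left ?_ hpos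
  calc ‖a m‖ * R ^ m * 2 ^ T.card = 16 ^ m * (‖a m‖ * (R ^ m / 16 ^ m) * 2 ^ T.card) := by
        field_simp
    _ ≤ 16 ^ m * (8 * K * (‖a m‖ * R ^ m)) := by gcongr
    _ = ‖a m‖ * R ^ m * (16 ^ m * (8 * K)) := by ring

lemma natCast_le_of_two_pow_le {n N : ℕ} {C : ℝ} (hC : 0 < C)
    (h : (2 : ℝ) ^ n ≤ 16 ^ N * (8 * max C 1)) : (n : ℝ) ≤ 5 * N + 5 * Real.log (C + 2) := by
  have hcube : 8 * max C 1 ≤ (C + 2) ^ 3 := by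
    rcases max_cases C 1 with ⟨h, _⟩ | ⟨h, _⟩ <;> rw [h] <;> nlinarith [pow_pos hC 2, pow_pos hC 3]
  have hlog := Real.log_le_log (by positivity) (h.trans (mul_le_mul_of_nonneg_left hcube
    (by positivity)))
  rw [Real.log_mul (by positivity) (by positivity), Real.log_pow, Real.log_pow, Real.log_pow,
    show (16 : ℝ) = 2 ^ 4 by norm_num, Real.log_pow] at hlog
  push_cast at hlog
  have hlog2 : 3 / 5 ≤ Real.log 2 := by linarith [Real.log_two_gt_d9]
  have hlogC : 0 ≤ Real.log (C + 2) := Real.log_nonneg (by linarith)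
  have hN : (0 : ℝ) ≤ N := N.cast_nonneg
  refine le_of_mul_le_mul_right ?_ (by linarith : 0 < Real.log 2)
  nlinarith [mul_nonneg hN (by linarith : 0 ≤ Real.log 2),
    mul_nonneg hlogC (sub_nonneg.2 hlog2)]

lemma Set.finite_and_ncard_le_of_forall_finset_card_le {α : Type*} {s : Set α} {B : ℝ}
    (h : ∀ T : Finset α, (T : Set α) ⊆ s → (T.card : ℝ) ≤ B) : s.Finite ∧ (s.ncard : ℝ) ≤ B := by
  have hs : s.Finite := by
    by_contra hs
    obtain ⟨n, hn⟩ := exists_nat_gt B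
    obtain ⟨T, hT, rfl⟩ := Set.Infinite.exists_subset_card_eq hs n
    exact (h T hT).not_gt hn
  refine ⟨hs, ?_⟩
  rw [Set.ncard_eq_toFinset_card s hs]
  exact h _ (by simp)

/-- **Zero-counting under Taylor domination** (Roytwarf–Yomdin).
If `f(z) = ∑ aₖ zᵏ` is analytic on `D_R`, not identically zero, and has the
`(N,R,C)`-Taylor domination property `|aₖ|·Rᵏ ≤ C·max_{0≤i≤N}|aᵢ|·Rⁱ` for `k ≥ N+1`,
then for every `0 < R' < R/4` the function `f` has at most `5N + 5·log(C+2)` zeros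
in the disk `D_{R'}`. -/
theorem zeros_of_taylor_domination (N : ℕ) (C R : ℝ) (hC : 0 < C) (hR : 0 < R)
    (a : ℕ → ℂ) (f : ℂ → ℂ)
    (hf : ∀ z ∈ Metric.ball (0 : ℂ) R, HasSum (fun k : ℕ => a k * z ^ k) (f z))
    (hne : ¬ ∀ z ∈ Metric.ball (0 : ℂ) R, f z = 0)
    (hdom : ∀ k : ℕ, N + 1 ≤ k →
      ‖a k‖ * R ^ k ≤ C * (Finset.Icc 0 N).sup' (Finset.nonempty_Icc.mpr (Nat.zero_le N))
        (fun i => ‖a i‖ * R ^ i))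
    (R' : ℝ) (hR'0 : 0 < R') (hR' : R' < R / 4) :
    {z : ℂ | ‖z‖ < R' ∧ f z = 0}.Finite ∧
    ({z : ℂ | ‖z‖ < R' ∧ f z = 0}.ncard : ℝ) ≤ 5 * N + 5 * Real.log (C + 2) := by
  obtain ⟨m, hmN, hm⟩ := Finset.exists_mem_eq_sup' (Finset.nonempty_Icc.mpr (Nat.zero_le N))
    (fun i => ‖a i‖ * R ^ i)
  have hle : ∀ k, ‖a k‖ * R ^ k ≤ max C 1 * (‖a m‖ * R ^ m) := by
    intro k
    rcases le_or_gt k N with hk | hk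
    · have h := Finset.le_sup' (fun i => ‖a i‖ * R ^ i) (Finset.mem_Icc.2 ⟨Nat.zero_le k, hk⟩)
      rw [hm] at h
      exact h.trans (le_mul_of_one_le_left (by positivity) (le_max_right C 1))
    · have h := hdom k hk
      rw [hm] at h
      exact h.trans (mul_le_mul_of_nonneg_right (le_max_left C 1) (by positivity))
  have ham : a m ≠ 0 := by
    intro ham
    have ha : ∀ k, a k = 0 := fun k => by
      have h := hle k
      rw [ham, norm_zero, zero_mul, mul_zero] at h
      exact norm_le_zero_iff.1 (nonpos_of_mul_nonpos_left h (pow_pos hR k))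
    refine hne fun z hz => (hf z hz).unique ?_
    simp [ha]
  refine Set.finite_and_ncard_le_of_forall_finset_card_le fun T hT => ?_
  refine natCast_le_of_two_pow_le hC ((two_pow_card_zeros_le hR hf ham hle T
    (fun w hw => ((hT hw).1.trans hR').le) fun w hw => (hT hw).2).trans ?_)
  gcongr
  · norm_num
  · exact (Finset.mem_Icc.1 hmN).2
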